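/- arXiv:1910.06441 — 6 statements merged into one kernel-verified Lean document; each statement's English description precedes it below -/
import Mathlib

section
/- For all constants c1 > 0, c2 > 0 and M > 0 there exists j1 ∈ ℕ such that the following holds for every natural number j ≥ j1: if α_1, …, α_j are real numbers satisfying the recursion α_{k+1} = α_k + α_k^4 · g_k for 1 ≤ k < j, where each g_k is a real number with |g_k| ≤ M, and if c1/j ≤ α_1 ≤ c2/j, then for every 1 ≤ k ≤ j one has c1/((1 + c1/j)^k · j) ≤ α_k ≤ c2 · (1 + c2/j)^k / j. -/
/-- One step of `a ↦ a + a ^ 4 * t` with `|t| ≤ M` and `0 ≤ a ≤ b` changes `a` by a factor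
between `1 - b ^ 3 * M` and `1 + b ^ 3 * M`. -/
theorem quartic_step_bounds {a b t M : ℝ} (ha : 0 ≤ a) (hab : a ≤ b) (ht : |t| ≤ M) :
    a * (1 - b ^ 3 * M) ≤ a + a ^ 4 * t ∧ a + a ^ 4 * t ≤ a * (1 + b ^ 3 * M) := by
  have h : |a ^ 3 * t| ≤ b ^ 3 * M := by
    rw [abs_mul, abs_of_nonneg (pow_nonneg ha 3)]
    have hb : 0 ≤ b := ha.trans hab
    gcongr
  obtain ⟨h1, h2⟩ := abs_le.mp h
  have h3 := mul_le_mul_of_nonneg_left h1 ha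
  have h4 := mul_le_mul_of_nonneg_left h2 ha
  constructor <;> linarith

theorem one_add_div_pow_le_exp {c : ℝ} (hc : 0 ≤ c) {k j : ℕ} (hj : 0 < j) (hk : k ≤ j) :
    (1 + c / (j : ℝ)) ^ k ≤ Real.exp c := by
  have hj' : (0 : ℝ) < j := by exact_mod_cast hj
  calc (1 + c / (j : ℝ)) ^ k ≤ (1 + c / (j : ℝ)) ^ j :=
        pow_le_pow_right₀ (le_add_of_nonneg_right (by positivity)) hk
    _ ≤ Real.exp (c / j) ^ j := by
        gcongr
        linarith [Real.add_one_le_exp (c / (j : ℝ))]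
    _ = Real.exp c := by
        rw [← Real.exp_nat_mul]
        congr 1
        field_simp

/-- Forward iteration bounds for the Lazutkin angle recursion
    `α_{k+1} = α_k + α_k^4 g_k` with `|g_k| ≤ M`. -/
theorem lazutkin_angle_iteration_bounds
    (c1 c2 M : ℝ) (hc1 : 0 < c1) (hc2 : 0 < c2) (hM : 0 < M) :
    ∃ j1 : ℕ, ∀ j : ℕ, j1 ≤ j →
      ∀ α g : ℕ → ℝ,
        (∀ k : ℕ, 1 ≤ k → k < j → α (k + 1) = α k + (α k) ^ 4 * g k) →
        (∀ k : ℕ, 1 ≤ k → k < j → |g k| ≤ M) →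
        c1 / (j : ℝ) ≤ α 1 → α 1 ≤ c2 / (j : ℝ) →
        ∀ k : ℕ, 1 ≤ k → k ≤ j →
          c1 / ((1 + c1 / (j : ℝ)) ^ k * (j : ℝ)) ≤ α k ∧
          α k ≤ c2 * (1 + c2 / (j : ℝ)) ^ k / (j : ℝ) := by
  set K : ℝ := (c2 * Real.exp c2) ^ 3 * M with hK
  have hK0 : 0 < K := by positivity
  obtain ⟨N, hN⟩ := exists_nat_ge (K * (1 + c1) / c1 + K / c2 + 1)
  refine ⟨N, fun j hNj α g hrec hg hl hu => ?_⟩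
  have hjN : K * (1 + c1) / c1 + K / c2 + 1 ≤ (j : ℝ) := hN.trans (by exact_mod_cast hNj)
  have hA : 0 < K * (1 + c1) / c1 := by positivity
  have hB : 0 < K / c2 := by positivity
  have hj1 : (1 : ℝ) ≤ j := by linarith
  have hj : (0 : ℝ) < j := by linarith
  have hjn : 0 < j := by exact_mod_cast hj
  have hKl : K * (1 + c1) ≤ j * c1 := (div_le_iff₀ hc1).mp (by linarith)
  have hKu : K ≤ j * c2 := (div_le_iff₀ hc2).mp (by linarith)
  have hε : (c2 * Real.exp c2 / j) ^ 3 * M = K / (j : ℝ) ^ 3 := by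
    rw [hK]
    ring
  have hQ : 1 + K / (j : ℝ) ^ 3 ≤ 1 + c2 / j := by
    gcongr 1 + ?_
    rw [div_le_div_iff₀ (by positivity) hj]
    calc K * j ≤ j * c2 * j := by gcongr
      _ = c2 * (j : ℝ) ^ 2 := by ring
      _ ≤ c2 * (j : ℝ) ^ 3 := by
        gcongr
        norm_num
  have hP0 : 0 < 1 + c1 / (j : ℝ) := by positivity
  have hP : 1 / (1 + c1 / (j : ℝ)) ≤ 1 - K / (j : ℝ) ^ 3 := by
    rw [div_le_iff₀ hP0]
    have h1 : K / (j : ℝ) ^ 3 * (1 + c1 / j) ≤ c1 / j := by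
      calc K / (j : ℝ) ^ 3 * (1 + c1 / j) ≤ K / (j : ℝ) ^ 2 * (1 + c1) := by
            gcongr
            · norm_num
            · exact div_le_self hc1.le hj1
        _ = K * (1 + c1) / (j : ℝ) ^ 2 := by ring
        _ ≤ j * c1 / (j : ℝ) ^ 2 := by gcongr
        _ = c1 / j := by field_simp
    linarith
  intro k hk
  induction k, hk using Nat.le_induction with
  | base =>
    intro _
    rw [pow_one, pow_one]
    constructor
    · refine le_trans ?_ hl
      gcongr
      exact le_mul_of_one_le_left hj.le (le_add_of_nonneg_right (by positivity))
    · refine hu.trans ?_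
      gcongr
      exact le_mul_of_one_le_right hc2.le (le_add_of_nonneg_right (by positivity))
  | succ k hk ih =>
    intro hkj
    obtain ⟨ihl, ihu⟩ := ih (by omega)
    have hα : 0 ≤ α k := le_trans (by positivity) ihl
    have hαb : α k ≤ c2 * Real.exp c2 / j := by
      refine ihu.trans ?_
      gcongr
      exact one_add_div_pow_le_exp hc2.le hjn (by omega)
    obtain ⟨hs1, hs2⟩ := quartic_step_bounds hα hαb (hg k hk (by omega))
    rw [hε] at hs1 hs2
    rw [hrec k hk (by omega)]
    constructor
    · calc c1 / ((1 + c1 / (j : ℝ)) ^ (k + 1) * j)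
          = c1 / ((1 + c1 / (j : ℝ)) ^ k * j) * (1 / (1 + c1 / (j : ℝ))) := by
            rw [div_mul_div_comm, pow_succ]
            ring
        _ ≤ α k * (1 - K / (j : ℝ) ^ 3) := by gcongr
        _ ≤ _ := hs1
    · calc _ ≤ α k * (1 + K / (j : ℝ) ^ 3) := hs2
        _ ≤ c2 * (1 + c2 / (j : ℝ)) ^ k / j * (1 + c2 / j) := by gcongr
        _ = c2 * (1 + c2 / (j : ℝ)) ^ (k + 1) / j := by ring
end

section
/- For all constants c1 > 0, c2 > 0 and M > 0 there exists j1 ∈ ℕ such that the following holds for every natural number j ≥ j1: if α_1, …, α_j are real numbers satisfying α_{k+1} = α_k + α_k^4 · g_k for 1 ≤ k < j with |g_k| ≤ M, and c1/j ≤ α_1 ≤ c2/j, then for every 1 ≤ k ≤ j one has c1 · e^{-c1} / j ≤ α_k ≤ c2 · e^{c2} / j. -/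
/-- As long as the total drift `j * (M * B ^ 4)` fits between the initial interval `[a, b]` and the
target interval `[A, B]`, a sequence with increments `α k ^ 4 * g k`, `|g k| ≤ M`, starting in
`[a, b]` drifts at most linearly and stays below `B` in absolute value. -/
theorem quartic_recursion_linear_drift {a b A B M : ℝ} {j : ℕ} {α g : ℕ → ℝ}
    (hA : 0 ≤ A) (hM : 0 ≤ M)
    (hlow : A ≤ a - j * (M * B ^ 4)) (hupp : b + j * (M * B ^ 4) ≤ B)
    (hrec : ∀ k : ℕ, 1 ≤ k → k < j → α (k + 1) = α k + α k ^ 4 * g k)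
    (hg : ∀ k : ℕ, 1 ≤ k → k < j → |g k| ≤ M)
    (ha : a ≤ α 1) (hb : α 1 ≤ b) {k : ℕ} (hk : 1 ≤ k) (hkj : k ≤ j) :
    a - k * (M * B ^ 4) ≤ α k ∧ α k ≤ b + k * (M * B ^ 4) := by
  have hD : 0 ≤ M * B ^ 4 := by positivity
  induction k, hk using Nat.le_induction with
  | base => push_cast; constructor <;> linarith
  | succ k hk ih =>
    obtain ⟨hl, hu⟩ := ih (by omega)
    have hkD : (k : ℝ) * (M * B ^ 4) ≤ j * (M * B ^ 4) := by
      gcongr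
      omega
    have h0 : 0 ≤ α k := by linarith
    have hB : α k ≤ B := by linarith
    have hstep : |α k ^ 4 * g k| ≤ M * B ^ 4 := by
      rw [abs_mul, abs_of_nonneg (by positivity : 0 ≤ α k ^ 4), mul_comm]
      have := hg k hk (by omega)
      gcongr
    obtain ⟨h1, h2⟩ := abs_le.mp hstep
    rw [hrec k hk (by omega)]
    push_cast
    constructor <;> linarith

/-- Uniform order-`1/j` bounds for the Lazutkin angle recursion
    `α_{k+1} = α_k + α_k^4 g_k` with `|g_k| ≤ M`. -/
theorem lazutkin_angle_uniform_bounds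
    (c1 c2 M : ℝ) (hc1 : 0 < c1) (hc2 : 0 < c2) (hM : 0 < M) :
    ∃ j1 : ℕ, ∀ j : ℕ, j1 ≤ j →
      ∀ α g : ℕ → ℝ,
        (∀ k : ℕ, 1 ≤ k → k < j → α (k + 1) = α k + (α k) ^ 4 * g k) →
        (∀ k : ℕ, 1 ≤ k → k < j → |g k| ≤ M) →
        c1 / (j : ℝ) ≤ α 1 → α 1 ≤ c2 / (j : ℝ) →
        ∀ k : ℕ, 1 ≤ k → k ≤ j →
          c1 * Real.exp (-c1) / (j : ℝ) ≤ α k ∧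
          α k ≤ c2 * Real.exp c2 / (j : ℝ) := by
  set K := c2 * Real.exp c2 with hK
  have hlow : 0 < c1 - c1 * Real.exp (-c1) := by
    have : Real.exp (-c1) < 1 := Real.exp_lt_one_iff.mpr (by linarith)
    nlinarith
  have hupp : 0 < K - c2 := by
    have : 1 < Real.exp c2 := Real.one_lt_exp_iff.mpr hc2
    rw [hK]
    nlinarith
  obtain ⟨δ, hδ, hδlow, hδupp⟩ :
      ∃ δ > 0, δ ≤ c1 - c1 * Real.exp (-c1) ∧ δ ≤ K - c2 :=
    ⟨_, lt_min hlow hupp, min_le_left _ _, min_le_right _ _⟩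
  obtain ⟨N, hN⟩ := exists_nat_ge (M * K ^ 4 / δ)
  refine ⟨N + 1, fun j hj α g hrec hg ha hb k hk hkj => ?_⟩
  have hNj : (N : ℝ) + 1 ≤ j := by exact_mod_cast hj
  have hj1 : (1 : ℝ) ≤ j := by linarith [(Nat.cast_nonneg N : (0 : ℝ) ≤ N)]
  have hj0 : (0 : ℝ) < j := by linarith
  have hdrift : j * (M * (K / j) ^ 4) ≤ δ / j := by
    have hMK : M * K ^ 4 ≤ δ * (j : ℝ) ^ 2 := by
      rw [div_le_iff₀ hδ] at hN
      nlinarith [mul_le_mul_of_nonneg_left (by nlinarith : (N : ℝ) ≤ (j : ℝ) ^ 2) hδ.le]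
    calc j * (M * (K / j) ^ 4) = M * K ^ 4 / (j : ℝ) ^ 3 := by field_simp
      _ ≤ δ * (j : ℝ) ^ 2 / (j : ℝ) ^ 3 := by gcongr
      _ = δ / j := by field_simp
  have hlow' : c1 * Real.exp (-c1) / j ≤ c1 / j - j * (M * (K / j) ^ 4) := by
    have : δ / j ≤ (c1 - c1 * Real.exp (-c1)) / j := by gcongr
    rw [sub_div] at this
    linarith
  have hupp' : c2 / j + j * (M * (K / j) ^ 4) ≤ K / j := by
    have : δ / j ≤ (K - c2) / j := by gcongr
    rw [sub_div] at this
    linarith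
  obtain ⟨hl, hu⟩ := quartic_recursion_linear_drift (by positivity) hM.le hlow' hupp'
    hrec hg ha hb hk hkj
  have hkD : (k : ℝ) * (M * (K / j) ^ 4) ≤ j * (M * (K / j) ^ 4) := by gcongr
  constructor <;> linarith
end

section
/- Let N be the 2×2 real matrix with entries N₁₁ = 0, N₁₂ = 1, N₂₁ = 0, N₂₂ = 0. For every C > 0 there exist C' > 0 and j4 ∈ ℕ such that for every natural number j ≥ j4 and all 2×2 real matrices E_1, …, E_j whose entries satisfy |(E_k)₁₁| ≤ C j⁻³, |(E_k)₁₂| ≤ C j⁻², |(E_k)₂₁| ≤ C j⁻⁴ and |(E_k)₂₂| ≤ C j⁻³ for every k, the product P = (I + N + E_j)·(I + N + E_{j−1})⋯(I + N + E_1) satisfies |P₁₁ − 1| ≤ C'/j, |P₁₂ − j| ≤ C'/j, |P₂₁| ≤ C'/j and |P₂₂ − 1| ≤ C'/j. -/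
/-- The ordered product `A n * A (n - 1) * ⋯ * A 1` gains its newest factor on the left. -/
lemma List.prod_map_range_sub_succ {M : Type*} [Monoid M] (A : ℕ → M) (n : ℕ) :
    ((List.range (n + 1)).map fun i => A (n + 1 - i)).prod =
      A (n + 1) * ((List.range n).map fun i => A (n - i)).prod := by
  rw [List.range_succ_eq_map, List.map_cons, List.prod_cons, List.map_map]
  simp [Function.comp_def]

lemma abs_mul_le_of_abs_le {x y u v : ℝ} (hx : |x| ≤ u) (hy : |y| ≤ v) : |x * y| ≤ u * v := by
  rw [abs_mul]
  exact mul_le_mul hx hy (abs_nonneg _) ((abs_nonneg _).trans hx)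

/-- Entrywise closeness of `Q` to `[[1, n], [0, 1]]`, at scale `e`. -/
def NearShear (C e n : ℝ) (Q : Matrix (Fin 2) (Fin 2) ℝ) : Prop :=
  |Q 0 0 - 1| ≤ 6 * C * n * e ^ 3 ∧ |Q 0 1 - n| ≤ 8 * C * n * e ^ 2 ∧
    |Q 1 0| ≤ 3 * C * n * e ^ 4 ∧ |Q 1 1 - 1| ≤ 4 * C * n * e ^ 3

/-- When `n * e ≤ 1`, the factor `n` in the bounds of `NearShear` can be traded for `e⁻¹`. -/
lemma NearShear.uniform {C e n : ℝ} (hC : 0 ≤ C) (he : 0 ≤ e) (hne : n * e ≤ 1)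
    {Q : Matrix (Fin 2) (Fin 2) ℝ} (hQ : NearShear C e n Q) :
    |Q 0 0 - 1| ≤ 6 * C * e ^ 2 ∧ |Q 0 1 - n| ≤ 8 * C * e ∧
      |Q 1 0| ≤ 3 * C * e ^ 3 ∧ |Q 1 1 - 1| ≤ 4 * C * e ^ 2 := by
  obtain ⟨h00, h01, h10, h11⟩ := hQ
  have trade (m : ℕ) : C * n * e ^ (m + 1) ≤ C * e ^ m := by
    have := mul_le_mul_of_nonneg_left hne (mul_nonneg hC (pow_nonneg he m))
    calc C * n * e ^ (m + 1) = C * e ^ m * (n * e) := by ring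
      _ ≤ C * e ^ m := by simpa using this
  have h1 := trade 1
  have h2 := trade 2
  have h3 := trade 3
  norm_num at h1 h2 h3
  exact ⟨by linarith, by linarith, by linarith, by linarith⟩

/-- One more factor `I + N + F` turns a perturbed shear by `n` into one by `n + 1`. -/
lemma NearShear.mul_left {C e J n : ℝ} (hC : 0 ≤ C) (he : 0 < e) (hJe : J * e = 1)
    (hsmall : 8 * C * e ^ 2 ≤ 1) (hn : 0 ≤ n) (hnJ : n ≤ J)
    {Q F : Matrix (Fin 2) (Fin 2) ℝ} (hQ : NearShear C e n Q)
    (h00 : |F 0 0| ≤ C * e ^ 3) (h01 : |F 0 1| ≤ C * e ^ 2)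
    (h10 : |F 1 0| ≤ C * e ^ 4) (h11 : |F 1 1| ≤ C * e ^ 3) :
    NearShear C e (n + 1)
      (((1 : Matrix (Fin 2) (Fin 2) ℝ) + !![(0:ℝ), 1; 0, 0] + F) * Q) := by
  have hne : n * e ≤ 1 := hJe ▸ mul_le_mul_of_nonneg_right hnJ he.le
  obtain ⟨u00, u01, u10, u11⟩ := hQ.uniform hC he.le hne
  obtain ⟨q00, q01, q10, q11⟩ := hQ
  have hCe : 0 ≤ C * e ^ 2 := by positivity
  have b00 : |Q 0 0| ≤ 2 := by
    rw [abs_le] at u00 ⊢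
    constructor <;> linarith
  have b11 : |Q 1 1| ≤ 2 := by
    rw [abs_le] at u11 ⊢
    constructor <;> linarith
  have hJ : 8 * C * e ≤ J := by
    calc 8 * C * e = 8 * C * e * (J * e) := by rw [hJe, mul_one]
      _ = 8 * C * e ^ 2 * J := by ring
      _ ≤ 1 * J := mul_le_mul_of_nonneg_right hsmall (hn.trans hnJ)
      _ = J := one_mul J
  have b01 : |Q 0 1| ≤ 2 * J := by
    rw [abs_le] at u01 ⊢
    constructor <;> linarith
  have b10 : |Q 1 0| ≤ e := by
    have : C * e ^ 2 * e ≤ 1 / 8 * e := mul_le_mul_of_nonneg_right (by linarith) he.le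
    calc |Q 1 0| ≤ 3 * (C * e ^ 2 * e) := by linarith
      _ ≤ e := by linarith
  have p1 := abs_le.mp (abs_mul_le_of_abs_le h00 b00)
  have p2 := abs_le.mp (abs_mul_le_of_abs_le h01 b10)
  have p3 := abs_le.mp (abs_mul_le_of_abs_le h00 b01)
  have p4 := abs_le.mp (abs_mul_le_of_abs_le h01 b11)
  have p5 := abs_le.mp (abs_mul_le_of_abs_le h10 b00)
  have p6 := abs_le.mp (abs_mul_le_of_abs_le h11 b10)
  have p7 := abs_le.mp (abs_mul_le_of_abs_le h10 b01)
  have p8 := abs_le.mp (abs_mul_le_of_abs_le h11 b11)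
  have r3 : C * e ^ 3 * (2 * J) = 2 * C * e ^ 2 := by linear_combination 2 * C * e ^ 2 * hJe
  have r7 : C * e ^ 4 * (2 * J) = 2 * C * e ^ 3 := by linear_combination 2 * C * e ^ 3 * hJe
  rw [r3] at p3
  rw [r7] at p7
  rw [abs_le] at u10 u11 q00 q01 q10 q11
  simp only [NearShear, Matrix.mul_apply, Fin.sum_univ_two, Matrix.add_apply, Matrix.one_apply,
    Matrix.of_apply, Matrix.cons_val', Matrix.cons_val_zero, Matrix.cons_val_one,
    Matrix.cons_val_fin_one, abs_le]
  norm_num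
  refine ⟨⟨?_, ?_⟩, ⟨?_, ?_⟩, ⟨?_, ?_⟩, ?_, ?_⟩ <;> linarith


/-- The Jacobian of the `j`-th iterate of the billiard map in Lazutkin
    coordinates equals `[[1, j],[0, 1]] + O(1/j)`: a product of `j` matrices
    `I + N + E_k`, with `N = [[0,1],[0,0]]` and `E_k` small, is
    `[[1, j],[0, 1]]` up to errors of size `1/j`. -/
theorem billiard_jacobian_product_asymptotics (C : ℝ) (hC : 0 < C) :
    ∃ C' : ℝ, 0 < C' ∧ ∃ j4 : ℕ, ∀ j : ℕ, j4 ≤ j →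
      ∀ E : ℕ → Matrix (Fin 2) (Fin 2) ℝ,
        (∀ k : ℕ, 1 ≤ k → k ≤ j →
          |E k 0 0| ≤ C / (j : ℝ) ^ 3 ∧ |E k 0 1| ≤ C / (j : ℝ) ^ 2 ∧
          |E k 1 0| ≤ C / (j : ℝ) ^ 4 ∧ |E k 1 1| ≤ C / (j : ℝ) ^ 3) →
        ∀ P : Matrix (Fin 2) (Fin 2) ℝ,
          P = (((List.range j).map fun i =>
                (1 : Matrix (Fin 2) (Fin 2) ℝ) + !![(0:ℝ), 1; 0, 0] + E (j - i))).prod →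
          |P 0 0 - 1| ≤ C' / (j : ℝ) ∧ |P 0 1 - (j : ℝ)| ≤ C' / (j : ℝ) ∧
          |P 1 0| ≤ C' / (j : ℝ) ∧ |P 1 1 - 1| ≤ C' / (j : ℝ) := by
  refine ⟨8 * C, by positivity, ⌈8 * C⌉₊ + 1, ?_⟩
  rintro j hj E hE P rfl
  have hj' : 8 * C + 1 ≤ (j : ℝ) := by
    have h : ((⌈8 * C⌉₊ + 1 : ℕ) : ℝ) ≤ j := Nat.cast_le.mpr hj
    push_cast at h
    linarith [Nat.le_ceil (8 * C)]
  have hj0 : (0 : ℝ) < j := by linarith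
  obtain ⟨e, he⟩ : ∃ e : ℝ, e = (j : ℝ)⁻¹ := ⟨_, rfl⟩
  have he0 : 0 < e := he ▸ inv_pos.mpr hj0
  have hJe : (j : ℝ) * e = 1 := he ▸ mul_inv_cancel₀ hj0.ne'
  have he1 : e ≤ 1 := he ▸ inv_le_one_of_one_le₀ (by linarith)
  have hsmall1 : 8 * C * e ≤ 1 := hJe ▸ mul_le_mul_of_nonneg_right (by linarith) he0.le
  have hsmall : 8 * C * e ^ 2 ≤ 1 := by
    calc 8 * C * e ^ 2 = 8 * C * e * e := by ring
      _ ≤ 1 := mul_le_one₀ hsmall1 he0.le he1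
  have near : ∀ n : ℕ, n ≤ j → NearShear C e n
      (((List.range n).map fun i =>
        (1 : Matrix (Fin 2) (Fin 2) ℝ) + !![(0:ℝ), 1; 0, 0] + E (n - i))).prod := by
    intro n
    induction n with
    | zero => intro _; simp [NearShear]
    | succ n ih =>
      intro hn
      rw [List.prod_map_range_sub_succ
        (fun k => (1 : Matrix (Fin 2) (Fin 2) ℝ) + !![(0:ℝ), 1; 0, 0] + E k) n, Nat.cast_succ]
      have hF := hE (n + 1) (by omega) hn
      simp only [div_eq_mul_inv, ← inv_pow, ← he] at hF
      exact (ih (by omega)).mul_left hC.le he0 hJe hsmall n.cast_nonneg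
        (Nat.cast_le.mpr (by omega)) hF.1 hF.2.1 hF.2.2.1 hF.2.2.2
  obtain ⟨h00, h01, h10, h11⟩ := (near j le_rfl).uniform hC.le he0.le hJe.le
  have hCe : 0 ≤ C * e := by positivity
  have e2 : C * e ^ 2 ≤ C * e := by
    calc C * e ^ 2 = C * e * e := by ring
      _ ≤ C * e := mul_le_of_le_one_right hCe he1
  have e3 : C * e ^ 3 ≤ C * e := by
    calc C * e ^ 3 = C * e ^ 2 * e := by ring
      _ ≤ C * e ^ 2 := mul_le_of_le_one_right (by positivity) he1
      _ ≤ C * e := e2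
  rw [div_eq_mul_inv, ← he]
  exact ⟨by linarith, h01, by linarith, by linarith⟩
end

section
/- Let N be the 2×2 real matrix with entries N₁₁ = 0, N₁₂ = 1, N₂₁ = 0, N₂₂ = 0. For every C > 0 there exists j4 ∈ ℕ such that for every natural number j ≥ j4 and all 2×2 real matrices E_1, …, E_j whose entries satisfy |(E_k)₁₁| ≤ C j⁻³, |(E_k)₁₂| ≤ C j⁻², |(E_k)₂₁| ≤ C j⁻⁴ and |(E_k)₂₂| ≤ C j⁻³ for every k, the product P = (I + N + E_j)·(I + N + E_{j−1})⋯(I + N + E_1) satisfies j/2 ≤ P₁₂ ≤ 2j and 1/2 ≤ P₂₂ ≤ 2. -/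
theorem prod_map_range_succ_sub {M : Type*} [Monoid M] (f : ℕ → M) (k : ℕ) :
    ((List.range (k + 1)).map fun i => f (k + 1 - i)).prod =
      f (k + 1) * ((List.range k).map fun i => f (k - i)).prod := by
  rw [List.range_succ_eq_map, List.map_cons, List.prod_cons, List.map_map]
  simp [Function.comp_def]

/-- One step of the perturbed shear `(x, y) ↦ (x + y, y)` increases the deviation of `(x, y)`
from the unperturbed orbit `(k, 1)` by at most `(8 * t * r, 4 * t)`. -/
theorem perturbed_shear_step {t r k a b c d x y : ℝ} (ht : 0 ≤ t) (hr : 1 ≤ r)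
    (htr : 16 * (t * r) ≤ 1) (hk : 0 ≤ k) (hkr : k + 1 ≤ r)
    (ha : |a| ≤ t) (hb : |b| ≤ t * r) (hc : |c| ≤ t / r) (hd : |d| ≤ t)
    (hx : |x - k| ≤ 8 * (k * t * r)) (hy : |y - 1| ≤ 4 * (k * t)) :
    |(1 + a) * x + (1 + b) * y - (k + 1)| ≤ 8 * ((k + 1) * t * r) ∧
      |c * x + (1 + d) * y - 1| ≤ 4 * ((k + 1) * t) := by
  have hkt : k * t ≤ t * r := by nlinarith
  have hktr : k * t * r ≤ r / 16 := by nlinarith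
  have hx' : |x| ≤ 2 * r := by
    rw [abs_le] at hx ⊢
    constructor <;> linarith
  have hy' : |y| ≤ 2 := by
    rw [abs_le] at hy ⊢
    constructor <;> linarith
  have hax : |a * x| ≤ t * (2 * r) := by
    rw [abs_mul]; gcongr
  have hby : |b * y| ≤ t * r * 2 := by
    rw [abs_mul]; gcongr
  have hcx : |c * x| ≤ 2 * t := by
    calc |c * x| ≤ t / r * (2 * r) := by rw [abs_mul]; gcongr
      _ = 2 * t := by field_simp
  have hdy : |d * y| ≤ t * 2 := by
    rw [abs_mul]; gcongr
  simp only [abs_le] at *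
  refine ⟨⟨?_, ?_⟩, ?_, ?_⟩ <;> linarith

theorem perturbed_shear_prod_deviation {t : ℝ} {j : ℕ} (ht : 0 ≤ t) (hj : 1 ≤ j)
    (htj : 16 * (t * j) ≤ 1) {E : ℕ → Matrix (Fin 2) (Fin 2) ℝ}
    (hE : ∀ k : ℕ, 1 ≤ k → k ≤ j →
      |E k 0 0| ≤ t ∧ |E k 0 1| ≤ t * j ∧ |E k 1 0| ≤ t / j ∧ |E k 1 1| ≤ t)
    (k : ℕ) (hk : k ≤ j) :
    |(((List.range k).map fun i =>
        (1 : Matrix (Fin 2) (Fin 2) ℝ) + !![(0:ℝ), 1; 0, 0] + E (k - i))).prod 0 1 - k|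
        ≤ 8 * (k * t * j) ∧
      |(((List.range k).map fun i =>
        (1 : Matrix (Fin 2) (Fin 2) ℝ) + !![(0:ℝ), 1; 0, 0] + E (k - i))).prod 1 1 - 1|
        ≤ 4 * (k * t) := by
  induction k with
  | zero => simp
  | succ k ih =>
    obtain ⟨hx, hy⟩ := ih (by omega)
    obtain ⟨ha, hb, hc, hd⟩ := hE (k + 1) (by omega) hk
    have hstep := perturbed_shear_step ht (by exact_mod_cast hj) htj (Nat.cast_nonneg k)
      (by exact_mod_cast hk) ha hb hc hd hx hy
    rw [prod_map_range_succ_sub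
      fun m => (1 : Matrix (Fin 2) (Fin 2) ℝ) + !![(0:ℝ), 1; 0, 0] + E m]
    simpa [Matrix.mul_apply, Fin.sum_univ_two] using hstep

/-- Comparability of the entries of the Jacobian of the `j`-th iterate of the
    billiard map in Lazutkin coordinates: the `(1,2)` entry is comparable to `j`
    and the `(2,2)` entry is comparable to `1`. -/
theorem billiard_jacobian_entry_comparability (C : ℝ) (hC : 0 < C) :
    ∃ j4 : ℕ, ∀ j : ℕ, j4 ≤ j →
      ∀ E : ℕ → Matrix (Fin 2) (Fin 2) ℝ,
        (∀ k : ℕ, 1 ≤ k → k ≤ j →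
          |E k 0 0| ≤ C / (j : ℝ) ^ 3 ∧ |E k 0 1| ≤ C / (j : ℝ) ^ 2 ∧
          |E k 1 0| ≤ C / (j : ℝ) ^ 4 ∧ |E k 1 1| ≤ C / (j : ℝ) ^ 3) →
        ∀ P : Matrix (Fin 2) (Fin 2) ℝ,
          P = (((List.range j).map fun i =>
                (1 : Matrix (Fin 2) (Fin 2) ℝ) + !![(0:ℝ), 1; 0, 0] + E (j - i))).prod →
          (j : ℝ) / 2 ≤ P 0 1 ∧ P 0 1 ≤ 2 * (j : ℝ) ∧
          1 / 2 ≤ P 1 1 ∧ P 1 1 ≤ 2 := by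
  obtain ⟨n, hn⟩ := exists_nat_ge (16 * C + 1)
  refine ⟨n, fun j hnj E hE P hP => ?_⟩
  have hj : 16 * C + 1 ≤ (j : ℝ) := hn.trans (by exact_mod_cast hnj)
  have hj1 : (1 : ℝ) ≤ j := by linarith
  have hj0 : (0 : ℝ) < j := by linarith
  have ht : 0 ≤ C / (j : ℝ) ^ 3 := by positivity
  have hb : C / (j : ℝ) ^ 3 * j = C / (j : ℝ) ^ 2 := by field_simp
  have hc : C / (j : ℝ) ^ 3 / j = C / (j : ℝ) ^ 4 := by field_simp
  have htj : 16 * (C / (j : ℝ) ^ 3 * j) ≤ 1 := by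
    rw [hb, ← mul_div_assoc, div_le_one (by positivity)]
    nlinarith
  obtain ⟨hx, hy⟩ := perturbed_shear_prod_deviation ht (by exact_mod_cast hj1) htj
    (by rwa [hb, hc]) j le_rfl
  rw [← hP, abs_le] at hx hy
  have hxj : (j : ℝ) * (C / (j : ℝ) ^ 3) * j ≤ j / 16 := by nlinarith
  refine ⟨?_, ?_, ?_, ?_⟩ <;> linarith
end

section
/- Let f : ℝ → ℝ be smooth on a neighborhood of 0 with f(0) = 0, f'(0) = 0 and f''(0) = 2, and let K ≥ 1. Then there exist constants C > 0 and δ > 0 such that for all b with 0 < b < δ and all t with √b / K ≤ t ≤ K √b, the quantity L(t, b) = log(t + f'(t)(f(t) − b)) − (1/2) log(t² + (f(t) − b)²) − (1/2) log(1 + f'(t)²) is well defined (the first argument being positive) and satisfies |L(t, b) + b²/(2 t²)| ≤ C b. -/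
theorem Real.abs_log_one_add_le_two_mul_abs {x : ℝ} (hx : |x| ≤ 1 / 2) :
    |Real.log (1 + x)| ≤ 2 * |x| := by
  obtain ⟨h₁, h₂⟩ := abs_le.mp hx
  have hpos : 0 < 1 + x := by linarith
  have hup := Real.log_le_sub_one_of_pos hpos
  have hlow := Real.one_sub_inv_le_log_of_pos hpos
  have hinv : -(2 * |x|) ≤ 1 - (1 + x)⁻¹ := by
    have h : 1 - (1 + x)⁻¹ = x / (1 + x) := by field_simp; ring
    rw [h, le_div_iff₀ hpos]
    rcases abs_cases x with ⟨h, _⟩ | ⟨h, _⟩ <;> rw [h] <;> nlinarith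
  rw [abs_le]
  constructor <;> linarith [le_abs_self x, abs_nonneg x]

/-- A function that vanishes to first order at `0` and has a second derivative there is
quadratically small near `0`, and its derivative is linearly small. -/
theorem exists_abs_le_mul_sq_and_abs_deriv_le_mul {f : ℝ → ℝ}
    (hf : ∀ᶠ x in nhds 0, DifferentiableAt ℝ f x) (hf' : DifferentiableAt ℝ (deriv f) 0)
    (hf0 : f 0 = 0) (hf'0 : deriv f 0 = 0) :
    ∃ M : ℝ, 0 < M ∧ ∃ r : ℝ, 0 < r ∧ ∀ t : ℝ, 0 ≤ t → t < r →
      |f t| ≤ M * t ^ 2 ∧ |deriv f t| ≤ M * t := by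
  obtain ⟨M, hM, hbound⟩ := hf'.isBigO_sub.exists_pos
  obtain ⟨r, hr, hball⟩ := Metric.eventually_nhds_iff.mp (hf.and hbound.bound)
  have hderiv : ∀ t : ℝ, 0 ≤ t → t < r → DifferentiableAt ℝ f t ∧ |deriv f t| ≤ M * t := by
    intro t ht htr
    have h := hball (y := t) (by simpa [abs_of_nonneg ht] using htr)
    simpa [hf'0, abs_of_nonneg ht] using h
  refine ⟨M, hM, r, hr, fun t ht htr => ⟨?_, (hderiv t ht htr).2⟩⟩
  have hmv := (convex_Icc (0 : ℝ) t).norm_image_sub_le_of_norm_deriv_le (f := f) (C := M * t)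
    (fun x hx => (hderiv x hx.1 (hx.2.trans_lt htr)).1)
    (fun x hx => (hderiv x hx.1 (hx.2.trans_lt htr)).2.trans
      (mul_le_mul_of_nonneg_left hx.2 hM.le))
    (Set.left_mem_Icc.mpr ht) (Set.right_mem_Icc.mpr ht)
  simp only [hf0, sub_zero, Real.norm_eq_abs, abs_of_nonneg ht] at hmv
  linarith [hmv, sq t, mul_assoc M t t]

/-- The logarithm of the cosine of the angle between the directions `(t, h)` and `(1, p)`,
together with the correction `b² / (2t²)`, is `O(b)` when `p = O(t)`, `h = O(b)` and
`t² ≍ b`. -/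
theorem abs_log_cos_add_le {b t p h K M N : ℝ} (hb : 0 < b) (ht : 0 < t)
    (hM : 0 ≤ M) (hbt : b ≤ K ^ 2 * t ^ 2) (htb : t ^ 2 ≤ K ^ 2 * b)
    (hp : |p| ≤ M * t) (hh : |h| ≤ N * b) (hsmall : M * N * b ≤ 1 / 2) :
    0 < t + p * h ∧
    |(Real.log (t + p * h) - (1 / 2) * Real.log (t ^ 2 + h ^ 2)
        - (1 / 2) * Real.log (1 + p ^ 2)) + b ^ 2 / (2 * t ^ 2)|
      ≤ (2 * M * N + N ^ 2 * K ^ 2 + M ^ 2 * K ^ 2 + K ^ 2) * b := by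
  have hx : |p * h / t| ≤ M * N * b := by
    rw [abs_div, abs_mul, abs_of_pos ht, div_le_iff₀ ht]
    calc |p| * |h| ≤ (M * t) * (N * b) := by gcongr
      _ = M * N * b * t := by ring
  have hx' := hx.trans hsmall
  have hfac : t + p * h = t * (1 + p * h / t) := by field_simp
  have hone : 0 < 1 + p * h / t := by linarith [(abs_le.mp hx').1]
  have hfac₂ : t ^ 2 + h ^ 2 = t ^ 2 * (1 + h ^ 2 / t ^ 2) := by field_simp
  have hbsq : b ^ 2 / t ^ 2 ≤ K ^ 2 * b := by
    rw [div_le_iff₀ (by positivity)]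
    nlinarith [mul_le_mul_of_nonneg_left hbt hb.le]
  have hhsq : h ^ 2 / t ^ 2 ≤ N ^ 2 * K ^ 2 * b := by
    have h₁ : h ^ 2 ≤ (N * b) ^ 2 := sq_le_sq' (abs_le.mp hh).1 (abs_le.mp hh).2
    calc h ^ 2 / t ^ 2 ≤ (N * b) ^ 2 / t ^ 2 := by gcongr
      _ = N ^ 2 * (b ^ 2 / t ^ 2) := by ring
      _ ≤ N ^ 2 * (K ^ 2 * b) := by gcongr
      _ = _ := by ring
  have hpsq : p ^ 2 ≤ M ^ 2 * K ^ 2 * b := by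
    calc p ^ 2 ≤ (M * t) ^ 2 := sq_le_sq' (abs_le.mp hp).1 (abs_le.mp hp).2
      _ = M ^ 2 * t ^ 2 := by ring
      _ ≤ M ^ 2 * (K ^ 2 * b) := by gcongr
      _ = _ := by ring
  have hlog_one_add : ∀ y : ℝ, 0 ≤ y → 0 ≤ Real.log (1 + y) ∧ Real.log (1 + y) ≤ y := by
    intro y hy
    exact ⟨Real.log_nonneg (by linarith),
      by linarith [Real.log_le_sub_one_of_pos (show 0 < 1 + y by linarith)]⟩
  obtain ⟨h₁, h₂⟩ := abs_le.mp (Real.abs_log_one_add_le_two_mul_abs hx')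
  obtain ⟨h₃, h₄⟩ := hlog_one_add (h ^ 2 / t ^ 2) (by positivity)
  obtain ⟨h₅, h₆⟩ := hlog_one_add (p ^ 2) (by positivity)
  have h₇ : 0 ≤ b ^ 2 / t ^ 2 := by positivity
  have h₈ : b ^ 2 / (2 * t ^ 2) = (b ^ 2 / t ^ 2) / 2 := by field_simp
  refine ⟨hfac ▸ mul_pos ht hone, ?_⟩
  rw [hfac, hfac₂, Real.log_mul ht.ne' hone.ne', Real.log_mul (by positivity) (by positivity),
    Real.log_pow, h₈, abs_le]
  push_cast
  constructor <;> linarith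


/-- In the parabolic regime `t ≍ √b`, the logarithm of the cosine of the first
    reflection angle satisfies `log cos α₁ = −b²/(2t²) + O(b)`. -/
theorem log_cos_parabolic_asymptotics (f : ℝ → ℝ) (K : ℝ)
    (hf : ContDiffAt ℝ (⊤ : ℕ∞) f 0) (hf0 : f 0 = 0)
    (hf'0 : deriv f 0 = 0) (hf''0 : deriv (deriv f) 0 = 2) (hK : 1 ≤ K) :
    ∃ C : ℝ, 0 < C ∧ ∃ δ : ℝ, 0 < δ ∧
      ∀ b : ℝ, 0 < b → b < δ →
        ∀ t : ℝ, Real.sqrt b / K ≤ t → t ≤ K * Real.sqrt b →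
          0 < t + deriv f t * (f t - b) ∧
          |(Real.log (t + deriv f t * (f t - b))
              - (1 / 2) * Real.log (t ^ 2 + (f t - b) ^ 2)
              - (1 / 2) * Real.log (1 + (deriv f t) ^ 2))
            + b ^ 2 / (2 * t ^ 2)| ≤ C * b := by
  have hdiff : ∀ᶠ x in nhds 0, DifferentiableAt ℝ f x :=
    ((hf.of_le (m := 1) (by exact_mod_cast le_top)).eventually (by simp)).mono
      fun x hx => hx.differentiableAt (by simp)
  have hdiff' : DifferentiableAt ℝ (deriv f) 0 :=
    differentiableAt_of_deriv_ne_zero (by rw [hf''0]; norm_num)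
  obtain ⟨M, hM, r, hr, hbound⟩ :=
    exists_abs_le_mul_sq_and_abs_deriv_le_mul hdiff hdiff' hf0 hf'0
  have hK0 : 0 < K := by linarith
  set N := M * K ^ 2 + 1 with hN
  have hN0 : 0 < N := by positivity
  refine ⟨2 * M * N + N ^ 2 * K ^ 2 + M ^ 2 * K ^ 2 + K ^ 2, by positivity,
    min ((r / K) ^ 2) (1 / (2 * (M * N))), by positivity, fun b hb hbδ t htl htu => ?_⟩
  have hsb : 0 < Real.sqrt b := Real.sqrt_pos.mpr hb
  have hsq : Real.sqrt b ^ 2 = b := Real.sq_sqrt hb.le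
  have ht : 0 < t := (div_pos hsb hK0).trans_le htl
  have htr : t < r := by
    have h := (Real.sqrt_lt' (by positivity)).mpr (hbδ.trans_le (min_le_left _ _))
    rw [lt_div_iff₀ hK0] at h
    linarith
  have hbt : b ≤ K ^ 2 * t ^ 2 := by
    rw [div_le_iff₀ hK0] at htl
    calc b = Real.sqrt b ^ 2 := hsq.symm
      _ ≤ (t * K) ^ 2 := by gcongr
      _ = K ^ 2 * t ^ 2 := by ring
  have htb : t ^ 2 ≤ K ^ 2 * b := by
    calc t ^ 2 ≤ (K * Real.sqrt b) ^ 2 := by gcongr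
      _ = K ^ 2 * b := by rw [mul_pow, hsq]
  have hsmall : M * N * b ≤ 1 / 2 := by
    have h := (hbδ.trans_le (min_le_right _ _)).le
    rw [le_div_iff₀ (by positivity)] at h
    linarith
  obtain ⟨hft, hpt⟩ := hbound t ht.le htr
  have hh : |f t - b| ≤ N * b := by
    calc |f t - b| ≤ |f t| + |b| := abs_sub _ _
      _ ≤ M * (K ^ 2 * b) + b := by
        rw [abs_of_pos hb]
        gcongr
        exact hft.trans (by gcongr)
      _ = N * b := by rw [hN]; ring
  exact abs_log_cos_add_le hb ht hM.le hbt htb hpt hh hsmall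
end

section
/- Let f : ℝ → ℝ be smooth on a neighborhood of 0 with f(0) = 0, f'(0) = 0 and f''(0) = 2. Then there exist constants δ > 0, r₀ > 0 and C > 0 such that for every r with 0 < r < r₀ and every t with 0 < t < δ satisfying the tangency equation f'(t)·t − f(t) = r · √(1 + f'(t)²), one has √r / 2 ≤ t ≤ 2 √r and 0 ≤ f'(t) ≤ C √r. -/
/-- A function vanishing at `0` whose derivative on `(0, t)` stays within `ε s` of `a s`
    stays within `ε t² / 2` of `a t² / 2` at `t`. -/
theorem abs_sub_half_mul_sq_le {f : ℝ → ℝ} {a ε t : ℝ} (ht : 0 < t)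
    (hd : ∀ s ∈ Set.Icc 0 t, DifferentiableAt ℝ f s) (hf0 : f 0 = 0)
    (hb : ∀ s ∈ Set.Ioo 0 t, |deriv f s - a * s| ≤ ε * s) :
    |f t - a / 2 * t ^ 2| ≤ ε / 2 * t ^ 2 := by
  have key : ∀ k s : ℝ, DifferentiableAt ℝ f s →
      HasDerivAt (fun x => f x - k / 2 * x ^ 2) (deriv f s - k * s) s := by
    intro k s hs
    refine (hs.hasDerivAt.sub ((hasDerivAt_pow 2 s).const_mul (k / 2))).congr_deriv ?_
    norm_num
    ring
  have mean : ∀ k : ℝ, ∃ c ∈ Set.Ioo 0 t,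
      f t - k / 2 * t ^ 2 = (deriv f c - k * c) * t := by
    intro k
    obtain ⟨c, hc, h⟩ := exists_hasDerivAt_eq_slope
      (fun x => f x - k / 2 * x ^ 2) (fun s => deriv f s - k * s) ht
      (fun s hs => (key k s (hd s hs)).continuousAt.continuousWithinAt)
      (fun s hs => key k s (hd s (Set.Ioo_subset_Icc_self hs)))
    refine ⟨c, hc, ?_⟩
    simp only [hf0] at h
    rw [eq_div_iff (by linarith)] at h
    linarith
  obtain ⟨c, hc, h₁⟩ := mean (a - ε)
  obtain ⟨d, hd', h₂⟩ := mean (a + ε)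
  have hbc := abs_le.1 (hb c hc)
  have hbd := abs_le.1 (hb d hd')
  have i₁ : 0 ≤ (deriv f c - (a - ε) * c) * t := mul_nonneg (by linarith) ht.le
  have i₂ : (deriv f d - (a + ε) * d) * t ≤ 0 :=
    mul_nonpos_of_nonpos_of_nonneg (by linarith) ht.le
  rw [abs_le]
  constructor <;> linarith

/-- Tangency points of lines through a boundary point with the inner parallel
    curve at distance `r` occur at parameter `t ≍ √r`, with tangency slope
    `f'(t) = O(√r)`. -/
theorem tangency_parameter_order (f : ℝ → ℝ)
    (hf : ContDiffAt ℝ (⊤ : ℕ∞) f 0) (hf0 : f 0 = 0)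
    (hf'0 : deriv f 0 = 0) (hf''0 : deriv (deriv f) 0 = 2) :
    ∃ δ : ℝ, 0 < δ ∧ ∃ r₀ : ℝ, 0 < r₀ ∧ ∃ C : ℝ, 0 < C ∧
      ∀ r : ℝ, 0 < r → r < r₀ →
        ∀ t : ℝ, 0 < t → t < δ →
          deriv f t * t - f t = r * Real.sqrt (1 + (deriv f t) ^ 2) →
          Real.sqrt r / 2 ≤ t ∧ t ≤ 2 * Real.sqrt r ∧
          0 ≤ deriv f t ∧ deriv f t ≤ C * Real.sqrt r := by
  have hdiff : ∀ᶠ s in nhds (0 : ℝ), DifferentiableAt ℝ f s := by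
    have h1 : ContDiffAt ℝ 1 f 0 := hf.of_le (by exact_mod_cast le_top)
    filter_upwards [h1.eventually (by simp)] with s hs
    exact hs.differentiableAt (by simp)
  have hd2 : HasDerivAt (deriv f) 2 0 := by
    rw [← hf''0]
    exact (differentiableAt_of_deriv_ne_zero (by rw [hf''0]; norm_num)).hasDerivAt
  have hbound : ∀ᶠ s in nhds (0 : ℝ), |deriv f s - 2 * s| ≤ 1 / 4 * |s| := by
    filter_upwards [hd2.isLittleO.def (show (0 : ℝ) < 1 / 4 by norm_num)] with s hs
    simpa [hf'0, mul_comm] using hs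
  obtain ⟨δ, hδ, hball⟩ := Metric.eventually_nhds_iff.1 (hdiff.and hbound)
  refine ⟨min δ (1 / 3), by positivity, 1, one_pos, 5, by norm_num, ?_⟩
  intro r hr _ t ht htδ heq
  have htδ' := htδ.trans_le (min_le_left _ _)
  have ht3 := htδ.trans_le (min_le_right _ _)
  have hnear : ∀ s ∈ Set.Icc 0 t, DifferentiableAt ℝ f s ∧ |deriv f s - 2 * s| ≤ 1 / 4 * s := by
    intro s hs
    have h := hball (y := s) (by
      rw [Real.dist_eq, sub_zero, abs_of_nonneg hs.1]
      exact hs.2.trans_lt htδ')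
    rwa [abs_of_nonneg hs.1] at h
  have hft := abs_le.1 (abs_sub_half_mul_sq_le ht (fun s hs => (hnear s hs).1) hf0
    (fun s hs => (hnear s (Set.Ioo_subset_Icc_self hs)).2))
  have hf't := abs_le.1 (hnear t ⟨ht.le, le_rfl⟩).2
  have hpos : 0 ≤ deriv f t := by linarith
  have hle : deriv f t ≤ 1 := by linarith
  have hs1 : 1 ≤ Real.sqrt (1 + deriv f t ^ 2) := Real.one_le_sqrt.2 (by nlinarith)
  have hs2 : Real.sqrt (1 + deriv f t ^ 2) ≤ 2 := Real.sqrt_le_iff.2 ⟨by norm_num, by nlinarith⟩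
  have hlower : r ≤ deriv f t * t - f t := by rw [heq]; nlinarith
  have hupper : deriv f t * t - f t ≤ 2 * r := by rw [heq]; nlinarith
  have hsq := Real.sq_sqrt hr.le
  have hsqpos := Real.sqrt_nonneg r
  have hA : Real.sqrt r / 2 ≤ t := by
    refine (pow_le_pow_iff_left₀ (by positivity) (by positivity) two_ne_zero).1 ?_
    nlinarith
  have hB : t ≤ 2 * Real.sqrt r := by
    refine (pow_le_pow_iff_left₀ (by positivity) (by positivity) two_ne_zero).1 ?_
    nlinarith
  exact ⟨hA, hB, hpos, by linarith⟩
end
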